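/- arXiv:1703.00885 — 2 statements merged into one kernel-verified Lean document; each statement's English description precedes it below -/
import Mathlib

section
/- Let m, d be natural numbers with d ≥ m+1, let c, C, ℓ > 0, and let L : ℝ^d → ℝ^m be a surjective linear map with ‖L‖_∞ ≤ C and dist(L, V_rank(m,d)) ≥ c. Let K = ker L. Then there is a constant K' depending only on m, d, c, C such that every v ∈ K^⊥ (the orthogonal complement of K) with ‖L v‖_∞ ≤ ℓ satisfies ‖v‖_∞ ≤ K'·ℓ. -/
theorem Matrix.mulVec_surjective_of_rank_eq {m d : ℕ} {A : Matrix (Fin m) (Fin d) ℝ}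
    (h : A.rank = m) : Function.Surjective A.mulVec := by
  have htop : LinearMap.range A.mulVecLin = ⊤ :=
    Submodule.eq_top_of_finrank_eq (by simpa [Matrix.rank] using h)
  exact LinearMap.range_eq_top.mp htop

/-- If `v ≠ 0` is orthogonal to `ker L`, then composing `L` with the orthogonal projection
onto `vᗮ` yields a rank-deficient matrix. -/
theorem Matrix.rank_sub_vecMulVec_ne {m d : ℕ} (L : Matrix (Fin m) (Fin d) ℝ) (v : Fin d → ℝ)
    (hv : ∀ w : Fin d → ℝ, L.mulVec w = 0 → v ⬝ᵥ w = 0) (hv0 : v ⬝ᵥ v ≠ 0) :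
    (L - (v ⬝ᵥ v)⁻¹ • Matrix.vecMulVec (L.mulVec v) v).rank ≠ m := by
  intro hrank
  obtain ⟨x, hx⟩ := Matrix.mulVec_surjective_of_rank_eq hrank (L.mulVec v)
  have hker : L.mulVec (x - (1 + (v ⬝ᵥ v)⁻¹ * (v ⬝ᵥ x)) • v) = 0 := by
    rw [Matrix.mulVec_sub, Matrix.mulVec_smul]
    ext i
    have hi := congrFun hx i
    simp only [Matrix.sub_mulVec, Matrix.smul_mulVec, Matrix.vecMulVec_mulVec, Pi.sub_apply,
      Pi.smul_apply, smul_eq_mul, MulOpposite.smul_eq_mul_unop, MulOpposite.unop_op,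
      Pi.zero_apply] at hi ⊢
    linear_combination hi
  have h := hv _ hker
  rw [dotProduct_sub, dotProduct_smul, smul_eq_mul] at h
  field_simp at h
  apply hv0
  linarith

theorem stmt_10 (m d : ℕ) (hd : m + 1 ≤ d) (c C : ℝ) (hc : 0 < c) (hC : 0 < C) :
    ∃ K > (0 : ℝ), ∀ L : Matrix (Fin m) (Fin d) ℝ,
      Function.Surjective L.mulVec →
      (∀ i j, |L i j| ≤ C) →
      (∀ L' : Matrix (Fin m) (Fin d) ℝ, (∀ i j, |L i j - L' i j| < c) → L'.rank = m) →
      ∀ l : ℝ, 0 < l → ∀ v : Fin d → ℝ,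
        (∀ w : Fin d → ℝ, L.mulVec w = 0 → ∑ i, v i * w i = 0) →
        (∀ i, |L.mulVec v i| ≤ l) →
        ∀ j, |v j| ≤ K * l := by
  refine ⟨c⁻¹, inv_pos.mpr hc, fun L _ _ hdist l hl v hv hLv j => ?_⟩
  have hsq : ∀ k, |v k| ^ 2 ≤ v ⬝ᵥ v := fun k => by
    rw [sq_abs, sq]
    exact Finset.single_le_sum (f := fun i => v i * v i) (fun i _ => mul_self_nonneg _)
      (Finset.mem_univ k)
  by_contra! hj
  have hlj : l < c * |v j| := by
    rwa [inv_mul_lt_iff₀ hc] at hj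
  have hjpos : 0 < |v j| := pos_of_mul_pos_right (hl.trans hlj) hc.le
  have hpos : 0 < v ⬝ᵥ v := (pow_pos hjpos 2).trans_le (hsq j)
  refine Matrix.rank_sub_vecMulVec_ne L v hv hpos.ne' (hdist _ fun i k => ?_)
  have hentry : L i k - (L - (v ⬝ᵥ v)⁻¹ • Matrix.vecMulVec (L.mulVec v) v) i k
      = (v ⬝ᵥ v)⁻¹ * (L.mulVec v i * v k) := by
    simp [Matrix.vecMulVec_apply]
  rw [hentry, abs_mul, abs_mul, abs_of_pos (inv_pos.mpr hpos), inv_mul_lt_iff₀ hpos]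
  have hprod : |v j| * |v k| ≤ v ⬝ᵥ v := by
    nlinarith [hsq j, hsq k, sq_nonneg (|v j| - |v k|)]
  rcases (abs_nonneg (v k)).eq_or_lt with hk | hk
  · rw [← hk, mul_zero]
    positivity
  · calc |L.mulVec v i| * |v k| ≤ l * |v k| := by gcongr; exact hLv i
      _ < c * |v j| * |v k| := by gcongr
      _ = c * (|v j| * |v k|) := mul_assoc _ _ _
      _ ≤ c * (v ⬝ᵥ v) := by gcongr
      _ = v ⬝ᵥ v * c := mul_comm _ _
end

section
/- Let N, m, d be natural numbers with d ≥ m+1, let c, C, ε > 0, and let L : ℝ^d → ℝ^m be a surjective linear map with ‖L‖_∞ ≤ C and dist(L, V_rank(m,d)) ≥ c. Let F : ℝ^d → [0,1] be supported on [−N,N]^d and G : ℝ^m → [0,1] be supported on [−ε,ε]^m. Then N^{-(d−m)} Σ_{n ∈ ℤ^d} F(n) G(L n) ≤ K · ‖G‖_∞, where K depends only on m, d, c, C, ε. -/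
/-- A real matrix of full row rank has an invertible square submatrix of full size. -/
theorem Matrix.exists_submatrix_det_ne_zero {m d : ℕ} (A : Matrix (Fin m) (Fin d) ℝ)
    (hA : A.rank = m) :
    ∃ f : Fin m → Fin d, Function.Injective f ∧ (A.submatrix id f).det ≠ 0 := by
  have hfr : Module.finrank ℝ (Submodule.span ℝ (Set.range A.col)) = m := by
    rw [← A.rank_eq_finrank_span_cols, hA]
  obtain ⟨g, hg, -, hli⟩ := Submodule.exists_fun_fin_finrank_span_eq ℝ (Set.range A.col)
  choose f hf using hg
  have hli' : LinearIndependent ℝ (A.submatrix id (f ∘ Fin.cast hfr.symm)).col := by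
    have h : (A.submatrix id (f ∘ Fin.cast hfr.symm)).col = g ∘ Fin.cast hfr.symm :=
      funext fun i => hf (Fin.cast hfr.symm i)
    rw [h]
    exact hli.comp _ (Fin.cast_injective _)
  refine ⟨f ∘ Fin.cast hfr.symm, Function.Injective.comp ?_ (Fin.cast_injective _), ?_⟩
  · intro i j hij
    exact hli.injective (by rw [← hf i, ← hf j, hij])
  · rw [← isUnit_iff_ne_zero, ← Matrix.isUnit_iff_isUnit_det]
    exact Matrix.linearIndependent_cols_iff_isUnit.1 hli'

/-- On a compact set of matrices of full row rank, some invertible square submatrix has an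
inverse with uniformly bounded entries. -/
theorem IsCompact.exists_bound_inv_submatrix {m d : ℕ} {S : Set (Matrix (Fin m) (Fin d) ℝ)}
    (hS : IsCompact S) (hrank : ∀ A ∈ S, A.rank = m) :
    ∃ R : ℝ, ∀ A ∈ S, ∃ f : Fin m → Fin d, Function.Injective f ∧
      (A.submatrix id f).det ≠ 0 ∧ ∀ i j, |(A.submatrix id f)⁻¹ i j| ≤ R := by
  refine hS.induction_on (p := fun s => ∃ R : ℝ, ∀ A ∈ s, ∃ f : Fin m → Fin d,
    Function.Injective f ∧ (A.submatrix id f).det ≠ 0 ∧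
      ∀ i j, |(A.submatrix id f)⁻¹ i j| ≤ R) ⟨0, by simp⟩ ?_ ?_ ?_
  · rintro s t hst ⟨R, hR⟩
    exact ⟨R, fun A hA => hR A (hst hA)⟩
  · rintro s t ⟨R, hR⟩ ⟨R', hR'⟩
    refine ⟨max R R', ?_⟩
    rintro A (hA | hA)
    · obtain ⟨f, hf, hdet, hb⟩ := hR A hA
      exact ⟨f, hf, hdet, fun i j => (hb i j).trans (le_max_left _ _)⟩
    · obtain ⟨f, hf, hdet, hb⟩ := hR' A hA
      exact ⟨f, hf, hdet, fun i j => (hb i j).trans (le_max_right _ _)⟩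
  · intro A hA
    obtain ⟨f, hf, hdet⟩ := A.exists_submatrix_det_ne_zero (hrank A hA)
    have hsub : Continuous fun B : Matrix (Fin m) (Fin d) ℝ => B.submatrix id f :=
      continuous_id.matrix_submatrix id f
    have hdet' : ∀ᶠ B in nhds A, (B.submatrix id f).det ≠ 0 :=
      hsub.matrix_det.continuousAt.eventually_ne hdet
    have hinv : ContinuousAt
        (fun B : Matrix (Fin m) (Fin d) ℝ => ∑ i, ∑ j, |(B.submatrix id f)⁻¹ i j|) A := by
      have h : ContinuousAt (fun B : Matrix (Fin m) (Fin d) ℝ => (B.submatrix id f)⁻¹) A := by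
        refine ContinuousAt.comp (g := Inv.inv) ?_ hsub.continuousAt
        refine continuousAt_matrix_inv _ ?_
        rw [Ring.inverse_eq_inv']
        exact continuousAt_inv₀ hdet
      refine tendsto_finsetSum _ fun i _ => tendsto_finsetSum _ fun j _ => ?_
      exact ((continuous_id.matrix_elem i j).continuousAt.comp h).abs
    have hlt := hinv.eventually (gt_mem_nhds (lt_add_one _))
    refine ⟨_, mem_nhdsWithin_of_mem_nhds (hdet'.and hlt),
      (∑ i, ∑ j, |(A.submatrix id f)⁻¹ i j|) + 1, ?_⟩
    rintro B ⟨hB, hB'⟩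
    refine ⟨f, hf, hB, fun i j => le_trans ?_ hB'.le⟩
    calc |(B.submatrix id f)⁻¹ i j| ≤ ∑ j, |(B.submatrix id f)⁻¹ i j| :=
          Finset.single_le_sum (f := fun j => |(B.submatrix id f)⁻¹ i j|)
            (fun _ _ => abs_nonneg _) (Finset.mem_univ j)
      _ ≤ _ := Finset.single_le_sum (f := fun i => ∑ j, |(B.submatrix id f)⁻¹ i j|)
            (fun _ _ => Finset.sum_nonneg fun _ _ => abs_nonneg _) (Finset.mem_univ i)

/-- The matrices with entries bounded by `C` all of whose `c`-perturbations have full row rank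
form a compact set. -/
theorem isCompact_setOf_bounded_robust_rank (m d : ℕ) (c C : ℝ) :
    IsCompact {L : Matrix (Fin m) (Fin d) ℝ | (∀ i j, |L i j| ≤ C) ∧
      ∀ L' : Matrix (Fin m) (Fin d) ℝ, (∀ i j, |L i j - L' i j| < c) → L'.rank = m} := by
  have hbox : IsCompact {L : Matrix (Fin m) (Fin d) ℝ | ∀ i j, |L i j| ≤ C} := by
    have h := isCompact_univ_pi (X := fun _ : Fin m => Fin d → ℝ) fun _ =>
      isCompact_univ_pi (X := fun _ : Fin d => ℝ) fun _ => isCompact_Icc (a := -C) (b := C)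
    have heq : {L : Matrix (Fin m) (Fin d) ℝ | ∀ i j, |L i j| ≤ C} =
        Set.univ.pi fun _ => Set.univ.pi fun _ => Set.Icc (-C) C := by
      ext L
      simp only [Set.mem_ofPred_eq, abs_le]
      exact ⟨fun h i _ j _ => h i j, fun h i j => h i trivial j trivial⟩
    rw [heq]
    exact h
  refine hbox.inter_right (t := {L | ∀ L' : Matrix (Fin m) (Fin d) ℝ,
    (∀ i j, |L i j - L' i j| < c) → L'.rank = m}) ?_
  have heq : {L : Matrix (Fin m) (Fin d) ℝ | ∀ L' : Matrix (Fin m) (Fin d) ℝ,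
      (∀ i j, |L i j - L' i j| < c) → L'.rank = m} =
      ⋂ L' ∈ {L' : Matrix (Fin m) (Fin d) ℝ | L'.rank ≠ m},
        ⋃ i, ⋃ j, {L | c ≤ |L i j - L' i j|} := by
    ext L
    simp only [Set.mem_ofPred_eq, Set.mem_iInter, Set.mem_iUnion]
    refine forall_congr' fun L' => ?_
    rw [← not_imp_not]
    push Not
    rfl
  rw [heq]
  refine isClosed_biInter fun L' _ => isClosed_iUnion_of_finite fun i =>
    isClosed_iUnion_of_finite fun j => isClosed_le continuous_const ?_
  exact ((continuous_id.matrix_elem i j).sub continuous_const).abs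

/-- A bound for the number of integer points of the box `[-N, N]^d` mapped by `L` into the cube
`[-ε, ε]^m`, when `L` has an invertible submatrix whose inverse has entries at most `R`. -/
theorem card_le_of_mem_box_of_mulVec_mem_cube {m d N k : ℕ} (hN : 0 < N) {R ε : ℝ}
    (L : Matrix (Fin m) (Fin d) ℝ) (f : Fin m → Fin d) (hf : Function.Injective f)
    (hdet : (L.submatrix id f).det ≠ 0) (hR : ∀ i j, |(L.submatrix id f)⁻¹ i j| ≤ R)
    (hk : m * (R * (2 * ε)) ≤ k) (T : Finset (Fin d → ℤ))
    (hbox : ∀ n ∈ T, ∀ i, n i ∈ Finset.Icc (-N : ℤ) N)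
    (hcube : ∀ n ∈ T, ∀ i, |L.mulVec (fun i => (n i : ℝ)) i| ≤ ε) :
    T.card ≤ (2 * k + 1) ^ m * (3 * N) ^ (d - m) := by
  classical
  let r : (Fin d → ℤ) → ({j // j ∉ Set.range f} → ℤ) := fun n j => n j
  have hmaps : ∀ n ∈ T, r n ∈ Fintype.piFinset fun _ => Finset.Icc (-N : ℤ) N :=
    fun n hn => Fintype.mem_piFinset.2 fun j => hbox n hn j
  refine (Finset.card_le_mul_card_image_of_maps_to hmaps ((2 * k + 1) ^ m) ?_).trans ?_
  · intro b _
    rcases (T.filter fun n => r n = b).eq_empty_or_nonempty with h | ⟨n₀, hn₀⟩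
    · simp [h]
    have hsplit : ∀ n ∈ T.filter (fun n => r n = b), ∀ j ∉ Set.range f, n j = n₀ j := by
      intro n hn j hj
      have h := (Finset.mem_filter.1 hn).2.trans (Finset.mem_filter.1 hn₀).2.symm
      exact congrFun h ⟨j, hj⟩
    have hdiff : ∀ n ∈ T.filter (fun n => r n = b), ∀ i, |n (f i) - n₀ (f i)| ≤ (k : ℤ) := by
      intro n hn
      let x : Fin m → ℝ := fun i => n (f i) - n₀ (f i)
      have hmul : (L.submatrix id f).mulVec x =
          L.mulVec (fun i => (n i : ℝ)) - L.mulVec (fun i => (n₀ i : ℝ)) := by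
        rw [← Matrix.mulVec_sub]
        ext i
        simp only [Matrix.mulVec, dotProduct, Matrix.submatrix_apply, id, x, Pi.sub_apply]
        refine Fintype.sum_of_injective f hf _ _ (fun j hj => ?_) fun _ => rfl
        rw [hsplit n hn j hj]
        simp
      have hx : x = (L.submatrix id f)⁻¹.mulVec ((L.submatrix id f).mulVec x) := by
        rw [Matrix.mulVec_mulVec, Matrix.nonsing_inv_mul _ (isUnit_iff_ne_zero.2 hdet),
          Matrix.one_mulVec]
      intro i
      have hy : ∀ j, |(L.submatrix id f).mulVec x j| ≤ 2 * ε := by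
        intro j
        rw [hmul, Pi.sub_apply]
        have h₁ := hcube n (Finset.mem_filter.1 hn).1 j
        have h₂ := hcube n₀ (Finset.mem_filter.1 hn₀).1 j
        rw [abs_le] at h₁ h₂ ⊢
        constructor <;> linarith
      have hxi : |x i| ≤ k := by
        rw [hx]
        refine le_trans ?_ hk
        rw [Matrix.mulVec, dotProduct]
        refine (Finset.abs_sum_le_sum_abs _ _).trans ?_
        calc _ ≤ ∑ _j : Fin m, R * (2 * ε) := Finset.sum_le_sum fun j _ => by
              rw [abs_mul]
              exact mul_le_mul (hR i j) (hy j) (abs_nonneg _) ((abs_nonneg _).trans (hR i j))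
          _ = _ := by simp
      have hcast : ((|n (f i) - n₀ (f i)| : ℤ) : ℝ) ≤ ((k : ℤ) : ℝ) := by
        push_cast
        exact hxi
      exact_mod_cast hcast
    calc _ ≤ (Fintype.piFinset fun _ : Fin m => Finset.Icc (-k : ℤ) k).card := by
          refine Finset.card_le_card_of_injOn (fun n i => n (f i) - n₀ (f i)) ?_ ?_
          · intro n hn
            simp only [Finset.mem_coe, Fintype.mem_piFinset, Finset.mem_Icc]
            exact fun i => abs_le.1 (hdiff n hn i)
          · intro n hn n' hn' h
            ext j
            by_cases hj : j ∈ Set.range f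
            · obtain ⟨i, rfl⟩ := hj
              simpa using congrFun h i
            · rw [hsplit n hn j hj, hsplit n' hn' j hj]
      _ = (2 * k + 1) ^ m := by
          simp only [Fintype.card_piFinset, Int.card_Icc, Finset.prod_const, Finset.card_univ,
            Fintype.card_fin]
          congr 1
          omega
  · refine Nat.mul_le_mul_left _ ?_
    have hcard : Fintype.card {j // j ∉ Set.range f} = d - m := by
      rw [Fintype.card_subtype_compl, Fintype.card_fin]
      congr 1
      exact (Set.card_range_of_injective hf).trans (Fintype.card_fin m)
    simp only [Fintype.card_piFinset, Int.card_Icc, Finset.prod_const, Finset.card_univ, hcard]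
    exact Nat.pow_le_pow_left (by omega) _

theorem stmt_19 (m d : ℕ) (hd : m + 1 ≤ d) (c C ε : ℝ)
    (hc : 0 < c) (hC : 0 < C) (hε : 0 < ε) :
    ∃ K > (0 : ℝ), ∀ N : ℕ, 0 < N →
      ∀ L : Matrix (Fin m) (Fin d) ℝ, Function.Surjective L.mulVec →
        (∀ i j, |L i j| ≤ C) →
        (∀ L' : Matrix (Fin m) (Fin d) ℝ, (∀ i j, |L i j - L' i j| < c) → L'.rank = m) →
      ∀ F : (Fin d → ℝ) → ℝ, (∀ v, 0 ≤ F v ∧ F v ≤ 1) →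
        (∀ v : Fin d → ℝ, (∃ i, (N : ℝ) < |v i|) → F v = 0) →
      ∀ G : (Fin m → ℝ) → ℝ, (∀ w, 0 ≤ G w ∧ G w ≤ 1) →
        (∀ w : Fin m → ℝ, (∃ i, ε < |w i|) → G w = 0) →
      ∀ B : ℝ, (∀ w, G w ≤ B) →
        (1 / (N : ℝ) ^ (d - m)) * ∑' n : Fin d → ℤ,
            F (fun i => (n i : ℝ)) * G (L.mulVec (fun i => (n i : ℝ))) ≤ K * B := by
  classical
  obtain ⟨R, hR⟩ := (isCompact_setOf_bounded_robust_rank m d c C).exists_bound_inv_submatrix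
    fun A hA => hA.2 A fun i j => by simpa using hc
  obtain ⟨k, hk⟩ := exists_nat_ge (m * (R * (2 * ε)))
  refine ⟨(2 * k + 1) ^ m * 3 ^ (d - m), by positivity, ?_⟩
  intro N hN L _ hLC hLc F hF hFsupp G hG hGsupp B hB
  obtain ⟨f, hf, hdet, hinv⟩ := hR L ⟨hLC, hLc⟩
  have hB0 : 0 ≤ B := (hG 0).1.trans (hB 0)
  let T : Finset (Fin d → ℤ) := (Fintype.piFinset fun _ => Finset.Icc (-N : ℤ) N).filter
    fun n => ∀ i, |L.mulVec (fun i => (n i : ℝ)) i| ≤ ε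
  have hT : (T.card : ℝ) ≤ (2 * k + 1) ^ m * (3 * N) ^ (d - m) := by
    exact_mod_cast card_le_of_mem_box_of_mulVec_mem_cube hN L f hf hdet hinv hk T
      (fun n hn => Fintype.mem_piFinset.1 (Finset.mem_filter.1 hn).1)
      (fun n hn => (Finset.mem_filter.1 hn).2)
  have hzero : ∀ n ∉ T, F (fun i => (n i : ℝ)) * G (L.mulVec (fun i => (n i : ℝ))) = 0 := by
    intro n hn
    by_cases hbox : ∃ i, (N : ℝ) < |(n i : ℝ)|
    · rw [hFsupp _ hbox, zero_mul]
    by_cases hcube : ∃ i, ε < |L.mulVec (fun i => (n i : ℝ)) i|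
    · rw [hGsupp _ hcube, mul_zero]
    push Not at hbox hcube
    refine absurd (Finset.mem_filter.2 ⟨Fintype.mem_piFinset.2 fun i => ?_, hcube⟩) hn
    exact Finset.mem_Icc.2 (abs_le.1 (by exact_mod_cast hbox i))
  have hsum : ∑ n ∈ T, F (fun i => (n i : ℝ)) * G (L.mulVec (fun i => (n i : ℝ))) ≤
      T.card * B := by
    rw [← nsmul_eq_mul]
    refine Finset.sum_le_card_nsmul _ _ _ fun n _ => ?_
    exact (mul_le_of_le_one_left (hG _).1 (hF _).2).trans (hB _)
  have hNpos : (0 : ℝ) < (N : ℝ) ^ (d - m) := by positivity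
  rw [tsum_eq_sum hzero, one_div_mul_eq_div, div_le_iff₀ hNpos]
  calc _ ≤ T.card * B := hsum
    _ ≤ ((2 * k + 1) ^ m * (3 * N) ^ (d - m)) * B := by gcongr
    _ = _ := by rw [mul_pow]; ring
end
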